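/- arXiv:2008.10403 — 2 statements merged into one kernel-verified Lean document; each statement's English description precedes it below -/
import Mathlib

section
/- Let n ≥ 2 and let d₁,…,d_n be integers with d_i ≥ 1 for every i and ∑_{i=1}^n d_i = 2(n−1). Then the number of trees T on the vertex set {1,…,n} such that deg_T(i) = d_i for every i equals (n−2)! / ∏_{i=1}^n (d_i − 1)!. -/
namespace SimpleGraph

/-- The trees on `V` in which every vertex `i` has degree `d i`. -/
def treesWithDegrees {V : Type*} (d : V → ℕ) : Set (SimpleGraph V) :=
  {T | T.IsTree ∧ ∀ i, (T.neighborSet i).ncard = d i}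

/-- The graph obtained from `G` by attaching a new vertex `none` to the vertex `u`. -/
def attachLeaf {W : Type*} (G : SimpleGraph W) (u : W) : SimpleGraph (Option W) :=
  G.map some ⊔ edge none (some u)

section attachLeaf

variable {W : Type*} (G : SimpleGraph W) (u : W)

@[simp]
lemma attachLeaf_adj_some_some (a b : W) :
    (G.attachLeaf u).Adj (some a) (some b) ↔ G.Adj a b := by
  simpa [attachLeaf, edge_adj, map_adj'] using fun h : G.Adj a b ↦ h.ne

@[simp]
lemma attachLeaf_adj_none_some (a : W) : (G.attachLeaf u).Adj none (some a) ↔ a = u := by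
  simp [attachLeaf, edge_adj, map_adj']

@[simp]
lemma attachLeaf_adj_some_none (a : W) : (G.attachLeaf u).Adj (some a) none ↔ a = u := by
  rw [adj_comm, attachLeaf_adj_none_some]

lemma neighborSet_attachLeaf_none : (G.attachLeaf u).neighborSet none = {some u} := by
  ext (_ | a) <;> simp

lemma ncard_neighborSet_attachLeaf_some [Finite W] [DecidableEq W] (a : W) :
    ((G.attachLeaf u).neighborSet (some a)).ncard =
      (G.neighborSet a).ncard + if a = u then 1 else 0 := by
  split_ifs with h
  · have : (G.attachLeaf u).neighborSet (some a) = insert none (some '' G.neighborSet a) := by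
      ext (_ | b) <;> simp [h]
    rw [this, Set.ncard_insert_of_notMem (by simp),
      Set.ncard_image_of_injective _ (Option.some_injective W)]
  · have : (G.attachLeaf u).neighborSet (some a) = some '' G.neighborSet a := by
      ext (_ | b) <;> simp [h]
    rw [this, Set.ncard_image_of_injective _ (Option.some_injective W), add_zero]

lemma connected_attachLeaf_iff : (G.attachLeaf u).Connected ↔ G.Connected := by
  constructor
  · intro h
    have key : ∀ a b, (G.attachLeaf u).Reachable a b → G.Reachable (a.getD u) (b.getD u) := by
      rintro a b ⟨p⟩
      induction p with
      | nil => rfl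
      | @cons a b c hab _ ih =>
        refine Reachable.trans ?_ ih
        rcases a with _ | a <;> rcases b with _ | b
        · rfl
        · rw [attachLeaf_adj_none_some] at hab
          simp [hab]
        · rw [attachLeaf_adj_some_none] at hab
          simp [hab]
        · exact ((attachLeaf_adj_some_some G u a b).1 hab).reachable
    have : Nonempty W := ⟨u⟩
    exact ⟨fun a b ↦ key (some a) (some b) (h.preconnected _ _)⟩
  · intro h
    let f : G →g G.attachLeaf u := ⟨some, fun h ↦ (attachLeaf_adj_some_some G u _ _).2 h⟩
    rw [connected_iff_exists_forall_reachable]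
    refine ⟨some u, ?_⟩
    rintro (_ | a)
    · exact ((attachLeaf_adj_some_none G u u).2 rfl).reachable
    · exact (h.preconnected u a).map f

lemma isTree_attachLeaf_iff [Finite W] : (G.attachLeaf u).IsTree ↔ G.IsTree := by
  have hcard : Nat.card (G.attachLeaf u).edgeSet = Nat.card G.edgeSet + 1 := by
    have : (G.attachLeaf u).edgeSet = insert s(none, some u) (Sym2.map some '' G.edgeSet) := by
      rw [attachLeaf, edgeSet_sup, edgeSet_edge_of_ne (by simp), Set.union_comm]
      exact congrArg (insert _) (edgeSet_map Function.Embedding.some G)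
    rw [this, Nat.card_coe_set_eq, Set.ncard_insert_of_notMem,
      Set.ncard_image_of_injective _ (Sym2.map.injective (Option.some_injective W)),
      Nat.card_coe_set_eq]
    rintro ⟨⟨a, b⟩, -, h⟩
    simp at h
  rw [isTree_iff_connected_and_card, isTree_iff_connected_and_card, connected_attachLeaf_iff,
    hcard, Finite.card_option, Nat.add_right_cancel_iff]

lemma exists_attachLeaf_eq {T : SimpleGraph (Option W)} (h : (T.neighborSet none).ncard = 1) :
    ∃ u G, attachLeaf G u = T := by
  obtain ⟨x, hx⟩ := Set.ncard_eq_one.1 h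
  have hT : ∀ y, T.Adj none y ↔ y = x := fun y ↦ by
    rw [← mem_neighborSet, hx, Set.mem_singleton_iff]
  rcases x with _ | u
  · exact absurd ((hT none).2 rfl) (T.irrefl)
  · refine ⟨u, T.comap some, ?_⟩
    ext (_ | a) (_ | b)
    · simp
    · simp [hT]
    · simp [T.adj_comm (some a), hT]
    · simp

end attachLeaf

lemma card_treesWithDegrees_option {W : Type*} [Fintype W] [DecidableEq W] (d : Option W → ℕ)
    (hd : d none = 1) :
    Nat.card (treesWithDegrees d) = ∑ u : W, Nat.card
      {G : SimpleGraph W | G.IsTree ∧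
        ∀ i, (G.neighborSet i).ncard + (if i = u then 1 else 0) = d (some i)} := by
  rw [← Nat.card_sigma]
  symm
  have hmem : ∀ (G : SimpleGraph W) u, G.attachLeaf u ∈ treesWithDegrees d ↔ G.IsTree ∧
        ∀ i, (G.neighborSet i).ncard + (if i = u then 1 else 0) = d (some i) := by
    intro G u
    simp [treesWithDegrees, isTree_attachLeaf_iff, Option.forall, neighborSet_attachLeaf_none, hd,
      ncard_neighborSet_attachLeaf_some]
  refine Nat.card_congr (Equiv.ofBijective
    (fun p ↦ ⟨attachLeaf p.2.1 p.1, (hmem _ _).2 p.2.2⟩) ⟨?_, ?_⟩)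
  · rintro ⟨u, G, hG⟩ ⟨v, H, hH⟩ h
    replace h : G.attachLeaf u = H.attachLeaf v := congrArg Subtype.val h
    obtain rfl : u = v := by
      rw [← attachLeaf_adj_none_some H v, ← h, attachLeaf_adj_none_some]
    obtain rfl : G = H := by
      ext a b
      rw [← attachLeaf_adj_some_some G u, h, attachLeaf_adj_some_some]
    rfl
  · rintro ⟨T, hT⟩
    obtain ⟨u, G, rfl⟩ := exists_attachLeaf_eq ((hT.2 none).trans hd)
    exact ⟨⟨u, G, (hmem _ _).1 hT⟩, rfl⟩

lemma card_treesWithDegrees_comp_equiv {V W : Type*} (e : V ≃ W) (d : W → ℕ) :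
    Nat.card (treesWithDegrees (d ∘ e)) = Nat.card (treesWithDegrees d) := by
  refine Nat.card_congr (e.simpleGraph.subtypeEquiv fun G ↦ ?_)
  let f : e.simpleGraph G ≃g G := Iso.comap e.symm G
  have hcard : ∀ i, ((e.simpleGraph G).neighborSet (e i)).ncard = (G.neighborSet i).ncard := by
    intro i
    rw [← Nat.card_coe_set_eq, ← Nat.card_coe_set_eq, Nat.card_congr (f.mapNeighborSet (e i))]
    simp [show f (e i) = i from e.symm_apply_apply i]
  change _ ∧ _ ↔ _ ∧ _
  rw [f.isTree_iff, ← e.forall_congr_right]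
  simp only [hcard, Function.comp_apply]

lemma one_le_of_mem_treesWithDegrees {V : Type*} [Finite V] [Nontrivial V] {d : V → ℕ}
    {T : SimpleGraph V} (hT : T ∈ treesWithDegrees d) (i : V) : 1 ≤ d i := by
  rw [← hT.2 i, Nat.one_le_iff_ne_zero, ← Nat.pos_iff_ne_zero, Set.ncard_pos]
  exact hT.1.connected.preconnected.exists_adj_of_nontrivial i

/-- A degree sequence of a tree can be realised with a leaf as distinguished vertex `none`. -/
lemma exists_option_equiv_of_sum_eq {V : Type*} [Fintype V] {m : ℕ} {d : V → ℕ}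
    (hV : Fintype.card V = m + 2) (hd : ∀ i, 1 ≤ d i) (hsum : ∑ i, d i = 2 * (m + 1)) :
    ∃ (p : V → Prop) (e : Option (Subtype p) ≃ V), d (e none) = 1 := by
  classical
  obtain ⟨v, hv⟩ : ∃ v, d v = 1 := by
    by_contra! h
    have : ∑ _i : V, 2 ≤ ∑ i, d i :=
      Finset.sum_le_sum fun i _ ↦ by have := hd i; have := h i; omega
    rw [Finset.sum_const, Finset.card_univ, hV, hsum, smul_eq_mul] at this
    omega
  exact ⟨_, Equiv.optionSubtypeNe v, by simpa using hv⟩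

lemma card_treesWithDegrees_option_of_unique {W : Type*} [Unique W] (d : Option W → ℕ)
    (hd : ∀ i, d i = 1) : Nat.card (treesWithDegrees d) = 1 := by
  classical
  rw [card_treesWithDegrees_option d (hd none), Fintype.sum_unique, Nat.card_eq_one_iff_unique]
  refine ⟨inferInstance, ⟨⊥, IsTree.of_subsingleton, fun i ↦ ?_⟩⟩
  have : (⊥ : SimpleGraph W).neighborSet i = ∅ := by ext; simp
  rw [this, Set.ncard_empty, if_pos (Subsingleton.elim _ _), hd]

theorem card_treesWithDegrees_mul_prod_factorial (m : ℕ) :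
    ∀ {V : Type*} [Fintype V] (d : V → ℕ), Fintype.card V = m + 2 → (∀ i, 1 ≤ d i) →
      ∑ i, d i = 2 * (m + 1) →
      Nat.card (treesWithDegrees d) * ∏ i, (d i - 1).factorial = m.factorial := by
  classical
  induction m with
  | zero =>
    intro V _ d hV hd hsum
    obtain ⟨p, e, he⟩ := exists_option_equiv_of_sum_eq hV hd hsum
    have hd1 : ∀ i, d i = 1 := by
      have hle : ∑ _i : V, 1 = ∑ i, d i := by
        rw [Finset.sum_const, Finset.card_univ, hV, hsum, smul_eq_mul]
      exact fun i ↦ ((Finset.sum_eq_sum_iff_of_le fun i _ ↦ hd i).1 hle i (Finset.mem_univ i)).symm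
    have hcard : Fintype.card (Subtype p) = 1 := by
      rw [← Fintype.card_congr e, Fintype.card_option] at hV
      omega
    obtain ⟨_⟩ := Fintype.card_eq_one_iff_nonempty_unique.1 hcard
    rw [← card_treesWithDegrees_comp_equiv e,
      card_treesWithDegrees_option_of_unique (d ∘ e) fun i ↦ hd1 _]
    simp [hd1]
  | succ m ih =>
    intro V _ d hV hd hsum
    obtain ⟨p, e, he⟩ := exists_option_equiv_of_sum_eq hV hd hsum
    have hcard : Fintype.card (Subtype p) = m + 2 := by
      rw [← Fintype.card_congr e, Fintype.card_option] at hV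
      omega
    have : Nontrivial (Subtype p) := Fintype.one_lt_card_iff_nontrivial.1 (by omega)
    rw [← card_treesWithDegrees_comp_equiv e, card_treesWithDegrees_option _ he, ← e.prod_comp,
      Fintype.prod_option, he, Nat.sub_self, Nat.factorial_zero, one_mul, Finset.sum_mul]
    rw [← e.sum_comp, Fintype.sum_option, he] at hsum
    set c : Subtype p → ℕ := fun i ↦ d (e (some i)) with hc
    change 1 + ∑ i, c i = _ at hsum
    have hc1 : ∀ i, 1 ≤ c i := fun i ↦ hd _
    have hterm : ∀ u, Nat.card {G : SimpleGraph (Subtype p) | G.IsTree ∧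
        ∀ i, (G.neighborSet i).ncard + (if i = u then 1 else 0) = c i} *
          ∏ i, (c i - 1).factorial = (c u - 1) * m.factorial := by
      intro u
      set c' : Subtype p → ℕ := fun i ↦ c i - if i = u then 1 else 0 with hc'
      have hset : {G : SimpleGraph (Subtype p) | G.IsTree ∧
          ∀ i, (G.neighborSet i).ncard + (if i = u then 1 else 0) = c i} =
            treesWithDegrees c' := by
        ext G
        refine and_congr_right fun _ ↦ forall_congr' fun i ↦ ?_
        have := hc1 i
        simp only [hc']
        split_ifs <;> omega
      rw [hset]
      rcases (hc1 u).eq_or_lt with hu | hu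
      · have : IsEmpty (treesWithDegrees c') := by
          refine ⟨fun T ↦ ?_⟩
          have := one_le_of_mem_treesWithDegrees T.2 u
          simp [hc', ← hu] at this
        simp [← hu]
      · have hprod : ∏ i, (c i - 1).factorial = (c u - 1) * ∏ i, (c' i - 1).factorial := by
          rw [Fintype.prod_eq_mul_prod_compl u, Fintype.prod_eq_mul_prod_compl u (fun i ↦
            (c' i - 1).factorial), ← mul_assoc]
          congr 1
          · simp only [hc', if_pos]
            exact (Nat.mul_factorial_pred (by omega)).symm
          · refine Finset.prod_congr rfl fun i hi ↦ ?_
            simp [hc', show i ≠ u by simpa using hi]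
        rw [hprod, mul_left_comm, ih c' hcard]
        · intro i
          have := hc1 i
          simp only [hc']
          split_ifs with h
          · subst h; omega
          · omega
        · have : ∑ i, c' i + ∑ i, (if i = u then 1 else 0) = ∑ i, c i := by
            rw [← Finset.sum_add_distrib]
            refine Finset.sum_congr rfl fun i _ ↦ Nat.sub_add_cancel ?_
            have := hc1 i
            split_ifs <;> omega
          simp only [Finset.sum_ite_eq', Finset.mem_univ, if_true] at this
          omega
    have hsub : ∑ i, (c i - 1) = m + 1 := by
      have : ∑ i, (c i - 1) + ∑ _i : Subtype p, 1 = ∑ i, c i := by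
        rw [← Finset.sum_add_distrib]
        exact Finset.sum_congr rfl fun i _ ↦ Nat.sub_add_cancel (hc1 i)
      rw [Finset.sum_const, Finset.card_univ, hcard, smul_eq_mul] at this
      omega
    refine (Finset.sum_congr rfl fun u _ ↦ hterm u).trans ?_
    rw [← Finset.sum_mul, hsub, Nat.factorial_succ]

end SimpleGraph

/-!
Statement 4: for `n ≥ 2` and integers `d₁,…,d_n ≥ 1` with `∑ d_i = 2(n−1)`, the number of
trees on `{1,…,n}` with `deg(i) = d_i` for every `i` equals `(n−2)! / ∏ (d_i − 1)!`.
-/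

theorem card_trees_with_given_degrees (n : ℕ) (hn : 2 ≤ n) (d : Fin n → ℕ)
    (hd : ∀ i, 1 ≤ d i) (hsum : ∑ i, d i = 2 * (n - 1)) :
    (Nat.card {T : SimpleGraph (Fin n) //
        T.IsTree ∧ ∀ i : Fin n, (T.neighborSet i).ncard = d i} : ℚ) =
      (Nat.factorial (n - 2) : ℚ) / ∏ i, (Nat.factorial (d i - 1) : ℚ) := by
  obtain ⟨m, rfl⟩ := Nat.exists_eq_add_of_le' hn
  rw [eq_div_iff (Finset.prod_ne_zero_iff.2 fun i _ ↦ by positivity)]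
  exact_mod_cast SimpleGraph.card_treesWithDegrees_mul_prod_factorial m d (by simp) hd hsum
end

section
/- For every integer n ≥ 1, ∑_λ ∑_ρ w(|ρ|) · (∏_{R ∈ ρ} w(|R|)) · (∏_{B ∈ λ} w(|B|)) ≤ 4^n · n!, where λ ranges over all set partitions of {1,…,n}, ρ ranges over all set partitions of the set of blocks of λ, |λ| and |ρ| denote the numbers of blocks, |B| is the cardinality of a block B of λ, |R| is the number of blocks of λ contained in a block R of ρ, and w(m) := (m−2)! for m ≥ 2 while w(0) := 1 and w(1) := 1 (the conventions 0! = (−1)! = 1). -/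
/-!
Statement 14: for every `n ≥ 1`,
`∑_λ ∑_ρ w(|ρ|) (∏_{R ∈ ρ} w(|R|)) (∏_{B ∈ λ} w(|B|)) ≤ 4^n n!`,
where `λ` ranges over set partitions of `{1,…,n}`, `ρ` over set partitions of the set of blocks
of `λ`, and `w(m) = (m−2)!` with the conventions `w(0) = w(1) = 1` (i.e. `0! = (−1)! = 1`);
note that with truncated natural subtraction `(m − 2)!` realizes exactly these conventions.
-/

open Finset

open scoped Classical in
/-- The set partitions of a finite set `S` into nonempty blocks, encoded as finsets of blocks. -/
noncomputable def setPartitions {α : Type*} [DecidableEq α] (S : Finset α) :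
    Finset (Finset (Finset α)) :=
  S.powerset.powerset.filter fun P =>
    (∀ B ∈ P, B.Nonempty) ∧ (∀ B ∈ P, ∀ B' ∈ P, B ≠ B' → Disjoint B B') ∧ P.sup id = S

lemma mem_setPartitions {α : Type*} [DecidableEq α] {S : Finset α} {P : Finset (Finset α)} :
    P ∈ setPartitions S ↔ (∀ B ∈ P, B.Nonempty) ∧
      (∀ B ∈ P, ∀ B' ∈ P, B ≠ B' → Disjoint B B') ∧ P.sup id = S := by
  simp only [setPartitions, mem_filter, mem_powerset, and_iff_right_iff_imp]
  rintro ⟨-, -, rfl⟩ B hB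
  exact mem_powerset.2 (le_sup (f := id) hB)

lemma setPartitions_empty {α : Type*} [DecidableEq α] :
    setPartitions (∅ : Finset α) = {∅} := by
  ext P
  rw [mem_setPartitions, mem_singleton]
  constructor
  · rintro ⟨hne, -, hsup⟩
    refine eq_empty_of_forall_notMem fun B hB => (hne B hB).ne_empty ?_
    exact subset_empty.1 (hsup ▸ le_sup (f := id) hB)
  · rintro rfl
    simp

lemma sum_card_of_mem_setPartitions {α : Type*} [DecidableEq α] {S : Finset α}
    {P : Finset (Finset α)} (hP : P ∈ setPartitions S) : ∑ B ∈ P, #B = #S := by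
  obtain ⟨-, hdis, rfl⟩ := mem_setPartitions.1 hP
  rw [sup_eq_biUnion]
  exact (card_biUnion hdis).symm

lemma card_le_of_mem_setPartitions {α : Type*} [DecidableEq α] {S : Finset α}
    {P : Finset (Finset α)} (hP : P ∈ setPartitions S) : #P ≤ #S := by
  rw [← sum_card_of_mem_setPartitions hP, card_eq_sum_ones]
  exact sum_le_sum fun B hB => ((mem_setPartitions.1 hP).1 B hB).card_pos

lemma subset_of_mem_setPartitions {α : Type*} [DecidableEq α] {S B : Finset α}
    {P : Finset (Finset α)} (hP : P ∈ setPartitions S) (hB : B ∈ P) : B ⊆ S := by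
  obtain ⟨-, -, rfl⟩ := mem_setPartitions.1 hP
  exact le_sup (f := id) hB

/-- A set partition of `insert a S` arises from one of `S` by adding the block `{a}` or by
inserting `a` into an existing block. -/
lemma setPartitions_insert_subset {α : Type*} [DecidableEq α] {S : Finset α} {a : α}
    (ha : a ∉ S) :
    setPartitions (insert a S) ⊆ (setPartitions S).biUnion fun P =>
      insert (insert {a} P) (P.image fun B => insert (insert a B) (P.erase B)) := by
  intro P hP
  obtain ⟨hne, hdis, hsup⟩ := mem_setPartitions.1 hP
  have hmem : ∀ x, (∃ B ∈ P, x ∈ B) ↔ x = a ∨ x ∈ S := fun x => by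
    rw [← mem_insert, ← hsup, mem_sup]; rfl
  obtain ⟨B, hB, haB⟩ := (hmem a).2 (Or.inl rfl)
  have huniq : ∀ C ∈ P, ∀ x ∈ C, x ∈ B → C = B := fun C hC x hxC hxB => by
    by_contra h
    exact disjoint_left.1 (hdis C hC B hB h) hxC hxB
  simp only [mem_biUnion, mem_insert, mem_image]
  rcases (B.erase a).eq_empty_or_nonempty with hBa | hBa
  · have hBeq : B = {a} := by rw [← insert_erase haB, hBa]; rfl
    subst hBeq
    refine ⟨P.erase {a}, mem_setPartitions.2 ⟨fun C hC => hne C (mem_of_mem_erase hC),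
      fun C hC D hD => hdis C (mem_of_mem_erase hC) D (mem_of_mem_erase hD), ?_⟩,
      Or.inl (insert_erase hB).symm⟩
    ext x
    simp only [mem_sup, mem_erase, id]
    grind
  · have hnot : B.erase a ∉ P.erase B := fun h => by
      obtain ⟨x, hx⟩ := hBa
      exact (mem_erase.1 h).1 (huniq _ (mem_of_mem_erase h) x hx (mem_of_mem_erase hx))
    refine ⟨insert (B.erase a) (P.erase B), mem_setPartitions.2 ⟨?_, ?_, ?_⟩,
      Or.inr ⟨B.erase a, mem_insert_self _ _, ?_⟩⟩
    · grind
    · intro C hC D hD hCD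
      rw [disjoint_left]
      intro x hxC hxD
      have := fun C hC D hD h => disjoint_left.1 (hdis C hC D hD h)
      grind
    · ext x
      simp only [mem_sup, mem_insert, mem_erase, id]
      grind
    · rw [erase_insert hnot, insert_erase haB, insert_erase hB]

lemma sum_setPartitions_insert_le {α : Type*} [DecidableEq α] {S : Finset α} {a : α}
    (ha : a ∉ S) (f : Finset (Finset α) → ℕ) :
    ∑ P ∈ setPartitions (insert a S), f P ≤ ∑ P ∈ setPartitions S,
      (f (insert {a} P) + ∑ B ∈ P, f (insert (insert a B) (P.erase B))) := by
  have himage : ∀ (P : Finset (Finset α)) (g : Finset α → Finset (Finset α)),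
      ∑ Q ∈ P.image g, f Q ≤ ∑ B ∈ P, f (g B) := fun P g => by
    rw [sum_comp f g]
    refine sum_le_sum fun Q hQ => ?_
    obtain ⟨B, hB, rfl⟩ := mem_image.1 hQ
    exact Nat.le_mul_of_pos_left _ (card_pos.2 ⟨B, mem_filter.2 ⟨hB, rfl⟩⟩)
  have hinsert : ∀ (Q : Finset (Finset α)) (T : Finset (Finset (Finset α))),
      ∑ R ∈ insert Q T, f R ≤ f Q + ∑ R ∈ T, f R := fun Q T => by
    by_cases h : Q ∈ T
    · simp [insert_eq_of_mem h]
    · rw [sum_insert h]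
  have hbiUnion : ∀ (T : Finset (Finset (Finset α)))
      (g : Finset (Finset α) → Finset (Finset (Finset α))),
      ∑ Q ∈ T.biUnion g, f Q ≤ ∑ P ∈ T, ∑ Q ∈ g P, f Q := fun T g => by
    induction T using Finset.induction with
    | empty => simp
    | insert P T hP ih =>
      rw [biUnion_insert, sum_insert hP]
      have := sum_union_inter (s₁ := g P) (s₂ := T.biUnion g) (f := f)
      omega
  refine (sum_le_sum_of_subset (setPartitions_insert_subset ha)).trans
    ((hbiUnion _ _).trans (sum_le_sum fun P _ => (hinsert _ _).trans ?_))
  exact Nat.add_le_add_left (himage P _) _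

lemma sum_setPartitions_le {α : Type*} [DecidableEq α] (c : ℕ) (S : Finset α) :
    ∑ P ∈ setPartitions S, c ^ #P * (#P).factorial * ∏ B ∈ P, (#B - 1).factorial ≤
      (c + 1) ^ #S * (#S).factorial := by
  induction S using Finset.induction with
  | empty => simp [setPartitions_empty]
  | insert a S ha ih =>
    refine (sum_setPartitions_insert_le ha _).trans ?_
    have hstep : ∀ P ∈ setPartitions S,
        (c ^ #(insert {a} P) * (#(insert {a} P)).factorial *
            ∏ C ∈ insert {a} P, (#C - 1).factorial) +
          ∑ B ∈ P, c ^ #(insert (insert a B) (P.erase B)) *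
            (#(insert (insert a B) (P.erase B))).factorial *
            ∏ C ∈ insert (insert a B) (P.erase B), (#C - 1).factorial ≤
        (c + 1) * (#S + 1) * (c ^ #P * (#P).factorial * ∏ B ∈ P, (#B - 1).factorial) := by
      intro P hP
      have hnot : ∀ C ∈ P, a ∉ C := fun C hC h => ha (subset_of_mem_setPartitions hP hC h)
      have hsingle : {a} ∉ P := fun h => hnot _ h (mem_singleton_self a)
      have hblock : ∀ B ∈ P, c ^ #(insert (insert a B) (P.erase B)) *
            (#(insert (insert a B) (P.erase B))).factorial *
            ∏ C ∈ insert (insert a B) (P.erase B), (#C - 1).factorial =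
          #B * (c ^ #P * (#P).factorial * ∏ B ∈ P, (#B - 1).factorial) := by
        intro B hB
        have hB' : insert a B ∉ P.erase B := fun h =>
          hnot _ (mem_of_mem_erase h) (mem_insert_self a B)
        rw [card_insert_of_notMem hB', card_erase_add_one hB, prod_insert hB',
          card_insert_of_notMem (hnot B hB), Nat.add_sub_cancel, ← mul_prod_erase P _ hB,
          ← Nat.mul_factorial_pred ((mem_setPartitions.1 hP).1 B hB).card_pos.ne']
        ring
      rw [sum_congr rfl hblock, ← sum_mul, sum_card_of_mem_setPartitions hP,
        card_insert_of_notMem hsingle, prod_insert hsingle, card_singleton, Nat.factorial_succ,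
        Nat.sub_self, Nat.factorial_zero, pow_succ]
      have hcard := card_le_of_mem_setPartitions hP
      calc _ = (c * (#P + 1) + #S) *
            (c ^ #P * (#P).factorial * ∏ B ∈ P, (#B - 1).factorial) := by ring
        _ ≤ _ := by
          gcongr
          nlinarith
    refine (sum_le_sum hstep).trans ?_
    rw [← mul_sum, card_insert_of_notMem ha, Nat.factorial_succ, pow_succ]
    calc _ ≤ (c + 1) * (#S + 1) * ((c + 1) ^ #S * (#S).factorial) := by gcongr
      _ = _ := by ring

theorem nested_partition_sum_le (n : ℕ) (hn : 1 ≤ n) :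
    ∑ lam ∈ setPartitions (Finset.univ : Finset (Fin n)),
      ∑ rho ∈ setPartitions lam,
        Nat.factorial (rho.card - 2) *
          ((∏ R ∈ rho, Nat.factorial (R.card - 2)) *
            ∏ B ∈ lam, Nat.factorial (B.card - 2)) ≤ 4 ^ n * Nat.factorial n := by
  have hprod : ∀ {β : Type} (P : Finset (Finset β)),
      ∏ B ∈ P, (#B - 2).factorial ≤ ∏ B ∈ P, (#B - 1).factorial := fun P =>
    prod_le_prod' fun B _ => Nat.factorial_le (by omega)
  have hinner : ∀ lam : Finset (Finset (Fin n)),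
      ∑ rho ∈ setPartitions lam, (#rho - 2).factorial *
          ((∏ R ∈ rho, (#R - 2).factorial) * ∏ B ∈ lam, (#B - 2).factorial) ≤
        2 ^ #lam * (#lam).factorial * ∏ B ∈ lam, (#B - 1).factorial := by
    intro lam
    simp only [← mul_assoc]
    rw [← sum_mul]
    refine Nat.mul_le_mul ((sum_le_sum fun rho _ => ?_).trans (sum_setPartitions_le 1 lam))
      (hprod lam)
    rw [one_pow, one_mul]
    exact Nat.mul_le_mul (Nat.factorial_le (Nat.sub_le _ _)) (hprod rho)
  refine (sum_le_sum fun lam _ => hinner lam).trans ((sum_setPartitions_le 2 _).trans ?_)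
  rw [card_univ, Fintype.card_fin]
  gcongr
  norm_num
end
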